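/- Let q be an odd prime power and F = F_q. There is no 3-dimensional F-subspace W of Sym₃(F) such that W contains exactly two 1-dimensional subspaces spanned by rank-1 matrices and fewer than q 1-dimensional subspaces spanned by rank-2 matrices. (Equivalently: there are no planes in PG(5,q) with rank distribution [2,n₂,n₃] where n₂ < q.) -/

import Mathlib

open Matrix

/-- The number of rank-`r` points of a subspace `W` of the space of `3 × 3` matrices over
`F`, i.e. the number of 1-dimensional subspaces of `W` spanned by a matrix of rank `r`. -/
noncomputable def ptCount (F : Type*) [Field F] (W : Submodule F (Matrix (Fin 3) (Fin 3) F)) (r : ℕ) : ℕ :=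
  Set.ncard {p : Submodule F (Matrix (Fin 3) (Fin 3) F) |
    p ≤ W ∧ Module.finrank F ↥p = 1 ∧ ∃ M ∈ p, M ≠ 0 ∧ M.rank = r}

theorem Matrix.rank_lt_card_of_det_eq_zero {n K : Type*} [Field K] [Fintype n] [DecidableEq n]
    {M : Matrix n n K} (h : M.det = 0) : M.rank < Fintype.card n := by
  obtain ⟨v, hv, hMv⟩ := Matrix.exists_mulVec_eq_zero_iff.mpr h
  have hker : 0 < Module.finrank K M.mulVecLin.ker :=
    Module.finrank_pos_iff_exists_ne_zero.mpr
      ⟨⟨v, by simpa using hMv⟩, fun h0 => hv (congrArg Subtype.val h0)⟩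
  have hsum := M.mulVecLin.finrank_range_add_finrank_ker
  rw [Module.finrank_fintype_fun_eq_card] at hsum
  rw [Matrix.rank]
  omega

theorem Matrix.eq_zero_of_rank_eq_zero {m n K : Type*} [Field K] [Finite m] [Fintype n]
    {M : Matrix m n K} (h : M.rank = 0) : M = 0 := by
  classical
  have h0 := Submodule.finrank_eq_zero.mp h
  ext i j
  have hj : M.mulVecLin (Pi.single j 1) = 0 := by
    simp [LinearMap.range_eq_bot.mp h0]
  simpa using congrFun hj i

/-- A symmetric matrix of rank one is a scalar multiple of some `a aᵀ`. -/
theorem Matrix.IsSymm.exists_eq_smul_vecMulVec {n K : Type*} [Field K] [Fintype n]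
    {M : Matrix n n K} (hM : M.IsSymm) (h : M.rank = 1) :
    ∃ (c : K) (a : n → K), c ≠ 0 ∧ M = c • Matrix.vecMulVec a a := by
  classical
  obtain ⟨v, hv, hspan⟩ := finrank_eq_one_iff'.mp h
  have hcol : ∀ j, ∃ k : K, ∀ i, M i j = k * v.1 i := fun j => by
    obtain ⟨k, hk⟩ := hspan ⟨M.mulVecLin (Pi.single j 1), LinearMap.mem_range_self _ _⟩
    refine ⟨k, fun i => ?_⟩
    simpa using (congrFun (congrArg Subtype.val hk) i).symm
  choose k hk using hcol
  obtain ⟨i₀, hi₀⟩ : ∃ i, v.1 i ≠ 0 := by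
    by_contra! h0
    exact hv (Subtype.ext (funext h0))
  have heq : M = (k i₀ / v.1 i₀) • Matrix.vecMulVec v.1 v.1 := by
    ext i j
    have hs : k j * v.1 i₀ = k i₀ * v.1 j := by
      rw [← hk, ← hk, hM.apply]
    rw [hk, Matrix.smul_apply, Matrix.vecMulVec_apply, smul_eq_mul]
    field_simp
    linear_combination v.1 i * hs
  refine ⟨_, _, fun h0 => ?_, heq⟩
  rw [h0, zero_smul] at heq
  simp [heq] at h

/-- A net of conics spanned by two squares of coordinate functions and one more conic contains a
degenerate conic off the pencil of the two squares. -/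
theorem Matrix.IsSymm.exists_det_add_diagonal_eq_zero {K : Type*} [Field K]
    {C : Matrix (Fin 3) (Fin 3) K} (hC : C.IsSymm) :
    ∃ x y : K, (C + Matrix.diagonal ![x, y, 0]).det = 0 := by
  have h10 := hC.apply 0 1
  have h20 := hC.apply 0 2
  have h21 := hC.apply 1 2
  simp only [Matrix.det_fin_three, Matrix.add_apply, Matrix.diagonal_apply]
  simp only [h10, h20, h21]
  simp
  generalize C 0 0 = a, C 0 1 = p, C 0 2 = r, C 1 1 = b, C 1 2 = s, C 2 2 = t
  by_cases ht : t = 0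
  · by_cases hs : s = 0
    · by_cases hr : r = 0
      · exact ⟨0, 0, by simp [ht, hs, hr]⟩
      · exact ⟨0, -b, by simp [ht, hs]⟩
    · refine ⟨(2 * p * r * s - r ^ 2 * b) / s ^ 2 - a, 0, ?_⟩
      subst ht
      field_simp
      ring
  · refine ⟨(r ^ 2 + (r * s - p * t)) / t - a, (s ^ 2 + (r * s - p * t)) / t - b, ?_⟩
    field_simp
    ring

theorem exists_det_of_rows_ne_zero {K : Type*} [Field K] {a b : Fin 3 → K}
    (h : LinearIndependent K ![a, b]) : ∃ c : Fin 3 → K, (Matrix.of ![a, b, c]).det ≠ 0 := by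
  obtain ⟨i, hi⟩ := Function.ne_iff.mp (crossProduct_ne_zero_iff_linearIndependent.mpr h)
  refine ⟨Pi.single i 1, fun h0 => hi ?_⟩
  rw [Matrix.det_fin_three] at h0
  fin_cases i <;> simp [cross_apply] at h0 ⊢ <;> linear_combination h0

theorem exists_det_add_smul_vecMulVec_eq_zero {K : Type*} [Field K] {a b : Fin 3 → K} {α β : K}
    (hα : α ≠ 0) (hβ : β ≠ 0) (h : LinearIndependent K ![a, b])
    {C : Matrix (Fin 3) (Fin 3) K} (hC : C.IsSymm) :
    ∃ x y : K, (C + x • α • Matrix.vecMulVec a a + y • β • Matrix.vecMulVec b b).det = 0 := by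
  obtain ⟨c, hc⟩ := exists_det_of_rows_ne_zero h
  set S := Matrix.of ![a, b, c] with hS
  have hu : IsUnit S.det := hc.isUnit
  have hC' : (S⁻¹ᵀ * C * S⁻¹).IsSymm := by
    simp [Matrix.IsSymm, Matrix.transpose_mul, hC.eq, Matrix.mul_assoc]
  obtain ⟨x, y, hxy⟩ := hC'.exists_det_add_diagonal_eq_zero
  refine ⟨x / α, y / β, ?_⟩
  have hCS : Sᵀ * (S⁻¹ᵀ * C * S⁻¹) * S = C := by
    rw [← Matrix.mul_assoc, ← Matrix.mul_assoc, ← Matrix.transpose_mul, Matrix.nonsing_inv_mul _ hu,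
      Matrix.mul_assoc, Matrix.nonsing_inv_mul _ hu]
    simp
  have hD : Sᵀ * Matrix.diagonal ![x, y, 0] * S =
      x • Matrix.vecMulVec a a + y • Matrix.vecMulVec b b := by
    ext i j
    simp [hS, Matrix.mul_apply, Fin.sum_univ_three, Matrix.vecMulVec_apply]
    ring
  rw [smul_smul, smul_smul, div_mul_cancel₀ _ hα, div_mul_cancel₀ _ hβ, add_assoc, ← hD, ← hCS,
    ← Matrix.add_mul, ← Matrix.mul_add, Matrix.det_mul, Matrix.det_mul, hxy]
  simp

theorem linearIndependent_pair_of_linearIndependent_smul_vecMulVec {n K : Type*} [Field K] {a b : n → K}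
    {A B : Matrix n n K} {α β : K} (hα : α ≠ 0)
    (hA : A = α • Matrix.vecMulVec a a) (hB : B = β • Matrix.vecMulVec b b)
    (h : LinearIndependent K ![A, B]) : LinearIndependent K ![a, b] := by
  have ha : a ≠ 0 := by
    rintro rfl
    exact h.ne_zero 0 (by simp [hA])
  refine (LinearIndependent.pair_iff' ha).mpr fun k hk => ?_
  refine (LinearIndependent.pair_iff' (h.ne_zero 0)).mp h (β * k ^ 2 / α) ?_
  subst hk
  ext i j
  simp [hA, hB, Matrix.vecMulVec_apply]
  field_simp

theorem Matrix.rank_add_le_rank_add_rank {m n K : Type*} [Field K] [Finite m] [Fintype n]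
    (A B : Matrix m n K) : (A + B).rank ≤ A.rank + B.rank := by
  have h : (A + B).mulVecLin.range ≤ A.mulVecLin.range ⊔ B.mulVecLin.range := by
    rw [Matrix.mulVecLin_add]
    exact LinearMap.range_add_le _ _
  exact (Submodule.finrank_mono h).trans (Submodule.finrank_add_le_finrank_add_finrank _ _)

/-- There is no plane of `PG(5,q)` (`q` odd) with rank distribution `[2, n₂, n₃]` where
`n₂ < q`: no 3-dimensional subspace of the symmetric `3 × 3` matrices over `F = F_q` contains
exactly two rank-1 points and fewer than `q` rank-2 points. -/
theorem no_plane_with_two_rank_one_points_and_few_rank_two_points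
    (F : Type*) [Field F] [Fintype F] (hodd : Odd (Fintype.card F)) :
    ¬ ∃ W : Submodule F (Matrix (Fin 3) (Fin 3) F),
      (∀ M ∈ W, M.IsSymm) ∧ Module.finrank F ↥W = 3 ∧
      ptCount F W 1 = 2 ∧ ptCount F W 2 < Fintype.card F := by
  classical
  rintro ⟨W, hsymm, hdim, h1, h2⟩
  obtain ⟨p, p', hne, hpts⟩ := Set.ncard_eq_two.mp h1
  obtain ⟨hpW, hp1, A, hAp, hA0, hAr⟩ := hpts.symm.subset (Set.mem_insert p _)
  obtain ⟨hpW', hp1', B, hBp, hB0, hBr⟩ := hpts.symm.subset (Set.mem_insert_of_mem p rfl)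
  have span_eq : ∀ {s : Submodule F (Matrix (Fin 3) (Fin 3) F)} {M : Matrix (Fin 3) (Fin 3) F},
      Module.finrank F s = 1 → M ∈ s → M ≠ 0 → s = Submodule.span F {M} := by
    intro s M hs hM hM0
    refine (Submodule.eq_of_le_of_finrank_eq ?_ ?_).symm
    · simpa using hM
    · rw [hs, finrank_span_singleton hM0]
  have hpA := span_eq hp1 hAp hA0
  have hpB := span_eq hp1' hBp hB0
  have hAW := hpW hAp
  have hBW := hpW' hBp
  have hAB : LinearIndependent F ![A, B] := by
    refine (LinearIndependent.pair_iff' hA0).mpr fun k hk => hne ?_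
    rw [hpB]
    exact span_eq hp1 (hk ▸ p.smul_mem k hAp) hB0
  obtain ⟨C, hCW, hC⟩ : ∃ C ∈ W, C ∉ Submodule.span F {A, B} := by
    by_contra! hle
    have hle' := Submodule.finrank_mono (show W ≤ Submodule.span F {A, B} from hle)
    have hcard : Module.finrank F (Submodule.span F (({A, B} :
        Finset (Matrix (Fin 3) (Fin 3) F)) : Set (Matrix (Fin 3) (Fin 3) F))) ≤ _ :=
      finrank_span_finset_le_card _
    have := Finset.card_le_two (a := A) (b := B)
    rw [Finset.coe_pair] at hcard
    omega
  obtain ⟨α, a, hα, hAa⟩ := (hsymm A hAW).exists_eq_smul_vecMulVec hAr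
  obtain ⟨β, b, hβ, hBb⟩ := (hsymm B hBW).exists_eq_smul_vecMulVec hBr
  obtain ⟨x, y, hxy⟩ := exists_det_add_smul_vecMulVec_eq_zero hα hβ
    (linearIndependent_pair_of_linearIndependent_smul_vecMulVec hα hAa hBb hAB) (hsymm C hCW)
  rw [← hAa, ← hBb] at hxy
  set D := C + x • A + y • B with hD_def
  have hAs : A ∈ Submodule.span F {A, B} := Submodule.subset_span (by simp)
  have hBs : B ∈ Submodule.span F {A, B} := Submodule.subset_span (by simp)
  have hDW : D ∈ W := W.add_mem (W.add_mem hCW (W.smul_mem _ hAW)) (W.smul_mem _ hBW)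
  have hD : D ∉ Submodule.span F {A, B} := by
    rwa [hD_def, Submodule.add_mem_iff_left _ (Submodule.smul_mem _ _ hBs),
      Submodule.add_mem_iff_left _ (Submodule.smul_mem _ _ hAs)]
  have rank_two : ∀ M ∈ W, M.rank ≤ 2 → M ∉ Submodule.span F {A} → M ∉ Submodule.span F {B} →
      Submodule.span F {M} ≤ W ∧ Module.finrank F ↥(Submodule.span F {M}) = 1 ∧
        ∃ N ∈ Submodule.span F {M}, N ≠ 0 ∧ N.rank = 2 := by
    intro M hMW hM hMA hMB
    have hM0 : M ≠ 0 := fun h => hMA (h ▸ Submodule.zero_mem _)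
    have hMs : M ∈ Submodule.span F {M} := Submodule.mem_span_singleton_self M
    have hle : Submodule.span F {M} ≤ W := by simpa using hMW
    refine ⟨hle, finrank_span_singleton hM0, M, hMs, hM0, ?_⟩
    have hr0 : M.rank ≠ 0 := fun h => hM0 (Matrix.eq_zero_of_rank_eq_zero h)
    have hr1 : M.rank ≠ 1 := fun h => by
      rcases hpts.subset ⟨hle, finrank_span_singleton hM0, M, hMs, hM0, h⟩ with h' | h'
      · exact hMA (hpA ▸ h' ▸ hMs)
      · exact hMB (hpB ▸ (Set.mem_singleton_iff.mp h') ▸ hMs)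
    omega
  have hpair := LinearIndependent.pair_iff.mp hAB
  let g : F → Matrix (Fin 3) (Fin 3) F := fun k => if k = 0 then D else A + k • B
  have hg0 : g 0 = D := if_pos rfl
  have hg : ∀ k ≠ 0, g k = A + k • B := fun k hk => if_neg hk
  have hgs : ∀ k ≠ 0, g k ∈ Submodule.span F {A, B} := fun k hk =>
    hg k hk ▸ Submodule.add_mem _ hAs (Submodule.smul_mem _ _ hBs)
  have hinj : Function.Injective fun k => Submodule.span F {g k} := by
    intro k l (hkl : Submodule.span F {g k} = Submodule.span F {g l})
    have hD_of : ∀ m ≠ 0, Submodule.span F {g 0} ≠ Submodule.span F {g m} := fun m hm h => by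
      refine hD ((Submodule.span_singleton_le_iff_mem _ _).mpr (hgs m hm) (h ▸ ?_))
      exact hg0 ▸ Submodule.mem_span_singleton_self _
    by_cases hk : k = 0
    · by_cases hl : l = 0
      · rw [hk, hl]
      · exact absurd (hk ▸ hkl) (hD_of l hl)
    · by_cases hl : l = 0
      · exact absurd (hl ▸ hkl.symm) (hD_of k hk)
      · have hm : g k ∈ Submodule.span F {g l} := hkl ▸ Submodule.mem_span_singleton_self _
        obtain ⟨c, hc⟩ := Submodule.mem_span_singleton.mp hm
        rw [hg k hk, hg l hl] at hc
        obtain ⟨hc1, hc2⟩ := hpair (c - 1) (c * l - k) (by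
          rw [sub_smul, sub_smul, mul_smul, one_smul]
          rw [smul_add] at hc
          rw [← sub_eq_zero] at hc
          rw [← hc]
          abel)
        linear_combination l * hc1 - hc2
  have hrange : Set.range (fun k => Submodule.span F {g k}) ⊆
      {p : Submodule F (Matrix (Fin 3) (Fin 3) F) |
        p ≤ W ∧ Module.finrank F ↥p = 1 ∧ ∃ M ∈ p, M ≠ 0 ∧ M.rank = 2} := by
    rintro _ ⟨k, rfl⟩
    by_cases hk : k = 0
    · subst hk
      have hDr := Matrix.rank_lt_card_of_det_eq_zero hxy
      rw [Fintype.card_fin] at hDr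
      refine rank_two (g 0) (hg0 ▸ hDW) (by rw [hg0]; omega) (fun h => hD ?_) (fun h => hD ?_)
      · exact (Submodule.span_singleton_le_iff_mem _ _).mpr hAs (hg0 ▸ h)
      · exact (Submodule.span_singleton_le_iff_mem _ _).mpr hBs (hg0 ▸ h)
    · have hkr : (k • B).rank = 1 := by
        rw [Matrix.rank_smul_of_mem_nonZeroDivisors _ (mem_nonZeroDivisors_of_ne_zero hk), hBr]
      refine rank_two (g k) ?_ ?_ ?_ ?_
      · exact hg k hk ▸ W.add_mem hAW (W.smul_mem _ hBW)
      · have := A.rank_add_le_rank_add_rank (k • B)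
        rw [hg k hk]
        omega
      · rw [hg k hk]
        intro h
        obtain ⟨c, hc⟩ := Submodule.mem_span_singleton.mp h
        exact hk (hpair (1 - c) k (by rw [sub_smul, hc]; module)).2
      · rw [hg k hk]
        intro h
        obtain ⟨c, hc⟩ := Submodule.mem_span_singleton.mp h
        exact one_ne_zero (hpair 1 (k - c) (by rw [sub_smul, hc]; module)).1
  have hcard := Set.ncard_le_ncard hrange (Set.toFinite _)
  rw [← Set.image_univ, Set.ncard_image_of_injective _ hinj, Set.ncard_univ,
    Nat.card_eq_fintype_card] at hcard
  exact absurd h2 (not_lt.mpr hcard)
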